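/- Let n ≥ 5 be an integer. The function z ↦ (‖z‖²−1)/(1+‖z‖²)ⁿ is integrable on ℝⁿ and its integral is strictly positive: ∫_{ℝⁿ} (‖z‖²−1)/(1+‖z‖²)ⁿ dz > 0. -/

import Mathlib

open MeasureTheory

theorem integrable_inv_one_add_norm_sq_pow {E : Type*} [NormedAddCommGroup E] [NormedSpace ℝ E]
    [FiniteDimensional ℝ E] [MeasurableSpace E] [BorelSpace E] (μ : Measure E)
    [μ.IsAddHaarMeasure] {m : ℕ} (hm : Module.finrank ℝ E < 2 * m) :
    Integrable (fun z : E => ((1 + ‖z‖ ^ 2) ^ m)⁻¹) μ := by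
  have h := integrable_rpow_neg_one_add_norm_sq (E := E) (μ := μ) (r := 2 * m)
    (by exact_mod_cast hm)
  refine h.congr (Filter.Eventually.of_forall fun z => ?_)
  have h0 : (0 : ℝ) ≤ 1 + ‖z‖ ^ 2 := by positivity
  have h1 : -(2 * (m : ℝ)) / 2 = -(m : ℝ) := by ring
  simp only [h1]
  rw [Real.rpow_neg h0, Real.rpow_natCast]

theorem integrable_sq_norm_sub_one_div {E : Type*} [NormedAddCommGroup E] [NormedSpace ℝ E]
    [FiniteDimensional ℝ E] [MeasurableSpace E] [BorelSpace E] (μ : Measure E)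
    [μ.IsAddHaarMeasure] {m : ℕ} (hm : Module.finrank ℝ E < 2 * m) :
    Integrable (fun z : E => (‖z‖ ^ 2 - 1) / (1 + ‖z‖ ^ 2) ^ (m + 1)) μ := by
  refine (integrable_inv_one_add_norm_sq_pow μ hm).mono'
    (Measurable.aestronglyMeasurable (by fun_prop)) (Filter.Eventually.of_forall fun z => ?_)
  have h0 : (0 : ℝ) < 1 + ‖z‖ ^ 2 := by positivity
  have h1 : |‖z‖ ^ 2 - 1| ≤ 1 + ‖z‖ ^ 2 := by
    rw [abs_le]; constructor <;> nlinarith [sq_nonneg ‖z‖]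
  rw [Real.norm_eq_abs, abs_div, abs_of_pos (pow_pos h0 _), div_le_iff₀ (pow_pos h0 _),
    pow_succ (1 + ‖z‖ ^ 2)]
  rwa [inv_mul_cancel_left₀ (pow_pos h0 _).ne']

theorem tendsto_pow_div_one_add_sq_pow_atTop (k : ℕ) :
    Filter.Tendsto (fun r : ℝ => r ^ (k + 3) / (1 + r ^ 2) ^ (k + 2)) Filter.atTop (nhds 0) := by
  refine squeeze_zero' ?_ ?_ tendsto_inv_atTop_zero
  · filter_upwards [Filter.eventually_ge_atTop 0] with r hr
    positivity
  · filter_upwards [Filter.eventually_ge_atTop 1] with r hr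
    have hr0 : 0 < r := by linarith
    rw [div_le_iff₀ (by positivity), inv_mul_eq_div, le_div_iff₀ hr0]
    calc r ^ (k + 3) * r = r ^ (k + 4) := by ring
      _ ≤ r ^ (2 * (k + 2)) := pow_le_pow_right₀ hr (by omega)
      _ = (r ^ 2) ^ (k + 2) := pow_mul _ _ _
      _ ≤ _ := by gcongr; linarith

theorem hasDerivAt_pow_div_one_add_sq_pow (k : ℕ) (r : ℝ) :
    HasDerivAt (fun r : ℝ => r ^ (k + 3) / (1 + r ^ 2) ^ (k + 2))
      (2 * (r ^ (k + 2) * ((1 + r ^ 2) ^ (k + 3))⁻¹) -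
        (k + 1) * (r ^ (k + 2) * ((r ^ 2 - 1) / (1 + r ^ 2) ^ (k + 3)))) r := by
  have h0 : (1 : ℝ) + r ^ 2 ≠ 0 := by positivity
  have h := (hasDerivAt_pow (k + 3) r).fun_div
    (((hasDerivAt_pow 2 r).const_add 1).fun_pow (k + 2)) (pow_ne_zero _ h0)
  refine h.congr_deriv ?_
  simp only [show k + 3 - 1 = k + 2 by omega, show k + 2 - 1 = k + 1 by omega]
  push_cast
  field_simp
  ring

theorem stmt12 (n : ℕ) (hn : 5 ≤ n) :
    Integrable (fun z : EuclideanSpace ℝ (Fin n) =>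
      (‖z‖ ^ 2 - 1) / (1 + ‖z‖ ^ 2) ^ n) ∧
    0 < ∫ z : EuclideanSpace ℝ (Fin n), (‖z‖ ^ 2 - 1) / (1 + ‖z‖ ^ 2) ^ n := by
  obtain ⟨k, rfl⟩ : ∃ k, n = k + 3 := ⟨n - 3, by omega⟩
  have hA := integrable_sq_norm_sub_one_div (E := EuclideanSpace ℝ (Fin (k + 3))) volume
    (m := k + 2) (by rw [finrank_euclideanSpace_fin]; omega)
  have hB := integrable_inv_one_add_norm_sq_pow (E := EuclideanSpace ℝ (Fin (k + 3))) volume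
    (m := k + 3) (by rw [finrank_euclideanSpace_fin]; omega)
  refine ⟨hA, ?_⟩
  have hA' := (integrable_fun_norm_addHaar volume
    (f := fun r : ℝ => (r ^ 2 - 1) / (1 + r ^ 2) ^ (k + 3))).1 hA
  have hB' := (integrable_fun_norm_addHaar volume
    (f := fun r : ℝ => ((1 + r ^ 2) ^ (k + 3))⁻¹)).1 hB
  rw [integral_fun_norm_addHaar volume (fun r : ℝ => (r ^ 2 - 1) / (1 + r ^ 2) ^ (k + 3))]
  simp only [finrank_euclideanSpace_fin, smul_eq_mul, nsmul_eq_mul,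
    show k + 3 - 1 = k + 2 by omega] at hA' hB' ⊢
  have hG := integral_Ioi_of_hasDerivAt_of_tendsto' (a := (0 : ℝ))
    (fun r _ => hasDerivAt_pow_div_one_add_sq_pow k r)
    ((hB'.const_mul 2).sub (hA'.const_mul ((k : ℝ) + 1)))
    (tendsto_pow_div_one_add_sq_pow_atTop k)
  rw [integral_sub (hB'.const_mul 2) (hA'.const_mul _), integral_const_mul,
    integral_const_mul] at hG
  have hpos : 0 < ∫ r in Set.Ioi (0 : ℝ), r ^ (k + 2) * ((1 + r ^ 2) ^ (k + 3))⁻¹ := by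
    have hp : ∀ r ∈ Set.Ioi (0 : ℝ), 0 < r ^ (k + 2) * ((1 + r ^ 2) ^ (k + 3))⁻¹ := by
      intro r hr
      have : 0 < r := hr
      positivity
    rw [setIntegral_pos_iff_support_of_nonneg_ae
      ((ae_restrict_mem measurableSet_Ioi).mono fun r hr => (hp r hr).le) hB',
      Set.inter_eq_right.2
        (show Set.Ioi (0 : ℝ) ⊆ Function.support _ from fun r hr => (hp r hr).ne')]
    simp
  have hvol : 0 < (volume : Measure (EuclideanSpace ℝ (Fin (k + 3)))).real (Metric.ball 0 1) :=
    ENNReal.toReal_pos (Metric.measure_ball_pos _ _ one_pos).ne' measure_ball_lt_top.ne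
  have hk : (0 : ℝ) < k + 1 := by positivity
  have hI : 0 < ∫ r in Set.Ioi (0 : ℝ), r ^ (k + 2) * ((r ^ 2 - 1) / (1 + r ^ 2) ^ (k + 3)) := by
    refine pos_of_mul_pos_right (a := (k : ℝ) + 1) ?_ hk.le
    simp at hG
    linarith
  positivity
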